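/- Let Ω ⊆ ℝ^m be a domain, and for w ∈ Ω let U_w ⊆ ℝ^n be a continuous bounded family of convex bodies such that for each ξ ∈ ℝ^n the support function w ↦ h_{U_w}(ξ) is superharmonic on Ω. Then the family is subharmonic in the sense that U_x ⊇ ∫_{∂B_ε(x)} U_y dS(y) for every closed ball B̄_ε(x) ⊆ Ω, and consequently w ↦ |U_w|^{1/n} is superharmonic. -/

import Mathlib

open MeasureTheory Metric Set Filter
open scoped RealInnerProductSpace NNReal ENNReal Pointwise Topology

/-- The support function of a set `A ⊆ ℝⁿ`: `h_A(ξ) = sup_{ζ ∈ A} ⟨ζ, ξ⟩`. -/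
noncomputable def suppFn {n : ℕ} (A : Set (EuclideanSpace ℝ (Fin n)))
    (ξ : EuclideanSpace ℝ (Fin n)) : ℝ :=
  sSup ((fun ζ => ⟪ζ, ξ⟫) '' A)

/-- The normalized surface measure on the sphere `∂B_ε(x) ⊆ ℝᵐ`. -/
noncomputable def sphereMeasure {m : ℕ} (x : EuclideanSpace ℝ (Fin m)) (ε : ℝ) :
    Measure (EuclideanSpace ℝ (Fin m)) :=
  (μH[(m : ℝ) - 1] (Metric.sphere x ε))⁻¹ • (μH[(m : ℝ) - 1]).restrict (Metric.sphere x ε)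

/-- One-dimensional Brunn-Minkowski for compact sets. -/
lemma bm_one_compact {K L : Set ℝ} (hK : IsCompact K) (hL : IsCompact L)
    (hK0 : K.Nonempty) (hL0 : L.Nonempty) : volume K + volume L ≤ volume (K + L) := by
  obtain ⟨a, haK, ha⟩ := hK.exists_isGreatest hK0
  obtain ⟨b, hbL, hb⟩ := hL.exists_isLeast hL0
  have h1 : volume ((fun x => x + b) '' K) = volume K := by
    rw [image_add_right, measure_preimage_add_right]
  have h2 : volume ((fun x => a + x) '' L) = volume L := by
    rw [image_add_left, measure_preimage_add]
  have hd : AEDisjoint volume ((fun x => x + b) '' K) ((fun x => a + x) '' L) := by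
    refine measure_mono_null (t := {a + b}) ?_ (by simp)
    rintro z ⟨⟨x, hx, rfl⟩, ⟨y, hy, hxy⟩⟩
    have := ha hx
    have := hb hy
    simp only at hxy ⊢
    rw [mem_singleton_iff]
    linarith
  have hm : NullMeasurableSet ((fun x => a + x) '' L) volume :=
    ((hL.image (by fun_prop)).measurableSet).nullMeasurableSet
  rw [← h1, ← h2, ← measure_union₀ hm hd]
  apply measure_mono
  rintro z (⟨x, hx, rfl⟩ | ⟨y, hy, rfl⟩)
  · exact add_mem_add hx hbL
  · exact add_mem_add haK hy

lemma bm_one {A B S : Set ℝ} (hA : MeasurableSet A) (hB : MeasurableSet B)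
    (hA0 : A.Nonempty) (hB0 : B.Nonempty) {l k : ℝ} (hl : 0 < l) (hk : 0 < k)
    (hS : ∀ x ∈ A, ∀ y ∈ B, l * x + k * y ∈ S) :
    ENNReal.ofReal l * volume A + ENNReal.ofReal k * volume B ≤ volume S := by
  have key : ∀ K L : Set ℝ, K ⊆ A → L ⊆ B → IsCompact K → IsCompact L → K.Nonempty →
      L.Nonempty → ENNReal.ofReal l * volume K + ENNReal.ofReal k * volume L ≤ volume S := by
    intro K L hKA hLB hK hL hK0 hL0
    have := bm_one_compact (hK.smul l) (hL.smul k) hK0.smul_set hL0.smul_set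
    rw [Measure.addHaar_smul, Measure.addHaar_smul] at this
    simp only [Module.finrank_self, pow_one, abs_of_pos hl, abs_of_pos hk] at this
    refine this.trans (measure_mono ?_)
    rintro _ ⟨_, ⟨x, hx, rfl⟩, _, ⟨y, hy, rfl⟩, rfl⟩
    exact hS x (hKA hx) y (hLB hy)
  have key1 : ∀ K L : Set ℝ, K ⊆ A → L ⊆ B → IsCompact K → IsCompact L →
      ENNReal.ofReal l * volume K + ENNReal.ofReal k * volume L ≤ volume S := by
    intro K L hKA hLB hK hL
    obtain ⟨a, ha⟩ := hA0
    obtain ⟨b, hb⟩ := hB0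
    refine le_trans ?_ (key (insert a K) (insert b L) (insert_subset ha hKA)
      (insert_subset hb hLB) (hK.insert a) (hL.insert b) (insert_nonempty _ _)
      (insert_nonempty _ _))
    gcongr <;> exact subset_insert _ _
  rw [hA.measure_eq_iSup_isCompact, hB.measure_eq_iSup_isCompact]
  simp only [ENNReal.mul_iSup]
  refine ENNReal.iSup_add_iSup_le ?_ |>.trans le_rfl
  intro K L
  by_cases h1 : K ⊆ A ∧ IsCompact K <;> by_cases h2 : L ⊆ B ∧ IsCompact L
  · simpa [h1.1, h1.2, h2.1, h2.2] using key1 K L h1.1 h2.1 h1.2 h2.2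
  · have := key1 K ∅ h1.1 (empty_subset _) h1.2 isCompact_empty
    have h3 : (⨆ (_ : L ⊆ B) (_ : IsCompact L), ENNReal.ofReal k * volume L) = 0 := by
      simp only [ENNReal.iSup_eq_zero]; tauto
    rw [h3]
    simpa [h1.1, h1.2] using this
  · have := key1 ∅ L (empty_subset _) h2.1 isCompact_empty h2.2
    have h3 : (⨆ (_ : K ⊆ A) (_ : IsCompact K), ENNReal.ofReal l * volume K) = 0 := by
      simp only [ENNReal.iSup_eq_zero]; tauto
    rw [h3]
    simpa [h2.1, h2.2] using this
  · have h3 : (⨆ (_ : K ⊆ A) (_ : IsCompact K), ENNReal.ofReal l * volume K) = 0 := by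
      simp only [ENNReal.iSup_eq_zero]; tauto
    have h4 : (⨆ (_ : L ⊆ B) (_ : IsCompact L), ENNReal.ofReal k * volume L) = 0 := by
      simp only [ENNReal.iSup_eq_zero]; tauto
    rw [h3, h4]; simp

/-- normalized one-dimensional Prekopa-Leindler -/
lemma pl_norm {f g h : ℝ → ℝ} (hf : Measurable f) (hg : Measurable g) (hh : Measurable h)
    (f0 : ∀ x, 0 ≤ f x) (g0 : ∀ x, 0 ≤ g x) (h0 : ∀ x, 0 ≤ h x)
    (f1 : ∀ x, f x ≤ 1) (g1 : ∀ x, g x ≤ 1)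
    (fs : ∀ t < 1, ∃ x, t < f x) (gs : ∀ t < 1, ∃ x, t < g x)
    {l k : ℝ} (hl : 0 < l) (hk : 0 < k)
    (H : ∀ x y, min (f x) (g y) ≤ h (l * x + k * y)) :
    ENNReal.ofReal l * (∫⁻ x, ENNReal.ofReal (f x)) + ENNReal.ofReal k *
      (∫⁻ x, ENNReal.ofReal (g x)) ≤ ∫⁻ x, ENNReal.ofReal (h x) := by
  rw [lintegral_eq_lintegral_meas_lt _ (.of_forall f0) hf.aemeasurable,
    lintegral_eq_lintegral_meas_lt _ (.of_forall g0) hg.aemeasurable,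
    lintegral_eq_lintegral_meas_lt _ (.of_forall h0) hh.aemeasurable]
  have mf : ∀ φ : ℝ → ℝ, Measurable (fun t => volume {a | t < φ a}) := by
    intro φ
    exact Antitone.measurable (fun s t hst => measure_mono fun a ha => lt_of_le_of_lt hst ha)
  rw [← lintegral_const_mul _ (mf f), ← lintegral_const_mul _ (mf g),
    ← lintegral_add_left ((mf f).const_mul _)]
  refine lintegral_mono fun t => ?_
  by_cases ht : t < 1
  · refine bm_one (measurableSet_lt measurable_const hf) (measurableSet_lt measurable_const hg)
      (fs t ht) (gs t ht) hl hk ?_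
    intro x hx y hy
    exact lt_of_lt_of_le (lt_min hx hy) (H x y)
  · have e1 : {a | t < f a} = ∅ := by
      ext a; have := f1 a; simp; linarith
    have e2 : {a | t < g a} = ∅ := by
      ext a; have := g1 a; simp; linarith
    simp [e1, e2]

lemma amgm_ennreal (a b : ℝ≥0∞) {l k : ℝ} (hl : 0 < l) (hk : 0 < k) (hlk : l + k = 1) :
    a ^ l * b ^ k ≤ ENNReal.ofReal l * a + ENNReal.ofReal k * b := by
  have hc : (l⁻¹).HolderConjugate k⁻¹ := by
    rw [Real.holderConjugate_iff]
    refine ⟨(one_lt_inv₀ hl).2 (by linarith), by simpa using hlk⟩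
  have := ENNReal.young_inequality (a ^ l) (b ^ k) hc
  rw [← ENNReal.rpow_mul, ← ENNReal.rpow_mul, mul_inv_cancel₀ hl.ne', mul_inv_cancel₀ hk.ne',
    ENNReal.rpow_one, ENNReal.rpow_one, ENNReal.ofReal_inv_of_pos hl,
    ENNReal.ofReal_inv_of_pos hk, div_eq_mul_inv, div_eq_mul_inv, inv_inv, inv_inv] at this
  rwa [mul_comm (ENNReal.ofReal l), mul_comm (ENNReal.ofReal k)]

lemma pl_one {f g h : ℝ → ℝ≥0∞} (hf : Measurable f) (hg : Measurable g) (hh : Measurable h)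
    {C : ℝ≥0∞} (hC : C ≠ ∞) (fC : ∀ x, f x ≤ C) (gC : ∀ x, g x ≤ C)
    {l k : ℝ} (hl : 0 < l) (hk : 0 < k) (hlk : l + k = 1)
    (H : ∀ x y, f x ^ l * g y ^ k ≤ h (l * x + k * y)) :
    (∫⁻ x, f x) ^ l * (∫⁻ x, g x) ^ k ≤ ∫⁻ x, h x := by
  by_cases c0 : (⨆ x, f x) = 0
  · rw [ENNReal.iSup_eq_zero] at c0
    simp [c0, hl]
  by_cases d0 : (⨆ x, g x) = 0
  · rw [ENNReal.iSup_eq_zero] at d0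
    simp [d0, hk]
  set c := ⨆ x, f x with hc
  set d := ⨆ x, g x with hd
  have c1 : c ≠ ∞ := ((iSup_le fC).trans_lt hC.lt_top).ne
  have d1 : d ≠ ∞ := ((iSup_le gC).trans_lt hC.lt_top).ne
  have fc : ∀ x, f x / c ≤ 1 := fun x => ENNReal.div_le_of_le_mul (by simpa using le_iSup f x)
  have gd : ∀ x, g x / d ≤ 1 := fun x => ENNReal.div_le_of_le_mul (by simpa using le_iSup g x)
  have sup_aux : ∀ (φ : ℝ → ℝ≥0∞) (c : ℝ≥0∞), c = (⨆ x, φ x) → c ≠ 0 → c ≠ ∞ →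
      (∀ x, φ x / c ≤ 1) → ∀ t < (1 : ℝ), ∃ x, t < (φ x / c).toReal := by
    intro φ c hc c0 c1 hφ t ht
    by_contra! hcon
    have h1 : c ≤ ENNReal.ofReal t * c := by
      conv_lhs => rw [hc]
      refine iSup_le fun x => ?_
      have := hcon x
      rw [← ENNReal.div_le_iff c0 c1]
      exact ENNReal.le_ofReal_iff_toReal_le ((hφ x).trans_lt ENNReal.one_lt_top).ne
        (ENNReal.toReal_nonneg.trans this) |>.2 this
    have h2 : ENNReal.ofReal t * c < 1 * c := by
      rw [ENNReal.mul_lt_mul_iff_left c0 c1]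
      simpa using ht
    rw [one_mul] at h2
    exact absurd h1 (not_le.2 h2)
  set D := c ^ l * d ^ k with hD
  have cl0 : c ^ l ≠ 0 := by simp [c0, c1, hl.not_gt]
  have cl1 : c ^ l ≠ ∞ := ENNReal.rpow_ne_top_of_nonneg hl.le c1
  have dk0 : d ^ k ≠ 0 := by simp [d0, d1, hk.not_gt]
  have dk1 : d ^ k ≠ ∞ := ENNReal.rpow_ne_top_of_nonneg hk.le d1
  have D0 : D ≠ 0 := mul_ne_zero cl0 dk0
  have D1 : D ≠ ∞ := ENNReal.mul_ne_top cl1 dk1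
  have hmin1 : ∀ x, min (h x / D) 1 ≠ ∞ := fun x =>
    ((min_le_right _ _).trans_lt ENNReal.one_lt_top).ne
  have f1t : ∀ x, f x / c ≠ ∞ := fun x => ((fc x).trans_lt ENNReal.one_lt_top).ne
  have g1t : ∀ x, g x / d ≠ ∞ := fun x => ((gd x).trans_lt ENNReal.one_lt_top).ne
  have key := pl_norm (f := fun x => (f x / c).toReal) (g := fun x => (g x / d).toReal)
    (h := fun x => (min (h x / D) 1).toReal) (by fun_prop) (by fun_prop) (by fun_prop)
    (fun _ => ENNReal.toReal_nonneg) (fun _ => ENNReal.toReal_nonneg)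
    (fun _ => ENNReal.toReal_nonneg)
    (fun x => ENNReal.toReal_le_of_le_ofReal zero_le_one (by simpa using fc x))
    (fun x => ENNReal.toReal_le_of_le_ofReal zero_le_one (by simpa using gd x))
    (sup_aux f c hc c0 c1 fc) (sup_aux g d hd d0 d1 gd) hl hk (by
      intro x y
      rw [← ENNReal.toReal_min (f1t x) (g1t y)]
      refine ENNReal.toReal_mono (hmin1 _) ?_
      refine le_min ?_ ((min_le_left _ _).trans (fc x))
      have e1 : min (f x / c) (g y / d) ≤ (f x / c) ^ l * (g y / d) ^ k := by
        calc min (f x / c) (g y / d) = (min (f x / c) (g y / d)) ^ l *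
              (min (f x / c) (g y / d)) ^ k := by
              rw [← ENNReal.rpow_add_of_nonneg _ _ hl.le hk.le, hlk, ENNReal.rpow_one]
          _ ≤ _ := by gcongr <;> simp
      refine e1.trans ?_
      rw [ENNReal.div_rpow_of_nonneg _ _ hl.le, ENNReal.div_rpow_of_nonneg _ _ hk.le,
        ENNReal.le_div_iff_mul_le (.inl D0) (.inl D1), hD]
      calc f x ^ l / c ^ l * (g y ^ k / d ^ k) * (c ^ l * d ^ k) 
          = (f x ^ l / c ^ l * c ^ l) * (g y ^ k / d ^ k * d ^ k) := by ring
        _ = f x ^ l * g y ^ k := by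
          rw [ENNReal.div_mul_cancel cl0 cl1, ENNReal.div_mul_cancel dk0 dk1]
        _ ≤ _ := H x y)
  simp only [ENNReal.ofReal_toReal (f1t _), ENNReal.ofReal_toReal (g1t _),
    ENNReal.ofReal_toReal (hmin1 _)] at key
  have key2 := (amgm_ennreal _ _ hl hk hlk).trans (key.trans
    (lintegral_mono fun x => min_le_left _ _))
  simp only [div_eq_mul_inv] at key2
  rw [lintegral_mul_const _ hf, lintegral_mul_const _ hg, lintegral_mul_const _ hh,
    ← div_eq_mul_inv, ← div_eq_mul_inv, ← div_eq_mul_inv,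
    ENNReal.div_rpow_of_nonneg _ _ hl.le, ENNReal.div_rpow_of_nonneg _ _ hk.le,
    ENNReal.le_div_iff_mul_le (.inl D0) (.inl D1), hD] at key2
  refine le_trans (le_of_eq ?_) key2
  calc (∫⁻ x, f x) ^ l * (∫⁻ x, g x) ^ k
      = ((∫⁻ x, f x) ^ l / c ^ l * c ^ l) * ((∫⁻ x, g x) ^ k / d ^ k * d ^ k) := by
          rw [ENNReal.div_mul_cancel cl0 cl1, ENNReal.div_mul_cancel dk0 dk1]
    _ = _ := by ring

lemma vol_slice {n : ℕ} {A : Set (Fin (n + 1) → ℝ)} (hA : IsCompact A) :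
    Measurable (fun t : ℝ => volume {v : Fin n → ℝ | (Fin.cons t v : Fin (n + 1) → ℝ) ∈ A}) ∧
    volume A = ∫⁻ t : ℝ, volume {v : Fin n → ℝ | (Fin.cons t v : Fin (n + 1) → ℝ) ∈ A} := by
  have hm := hA.measurableSet
  have hp := (volume_preserving_piFinSuccAbove (fun _ : Fin (n + 1) => ℝ) 0).symm
  have hm2 := (MeasurableEquiv.piFinSuccAbove (fun _ : Fin (n + 1) => ℝ) 0).symm.measurable hm
  have e : ∀ t : ℝ, {v : Fin n → ℝ | (Fin.cons t v : Fin (n + 1) → ℝ) ∈ A} = Prod.mk t ⁻¹'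
      ((MeasurableEquiv.piFinSuccAbove (fun _ : Fin (n + 1) => ℝ) 0).symm ⁻¹' A) := by
    intro t
    ext v
    simp [MeasurableEquiv.piFinSuccAbove, Fin.insertNthEquiv]
  simp only [e]
  refine ⟨measurable_measure_prodMk_left hm2, ?_⟩
  rw [← hp.measure_preimage hm.nullMeasurableSet, Measure.volume_eq_prod,
    Measure.prod_apply hm2]

lemma slice_compact {n : ℕ} {A : Set (Fin (n + 1) → ℝ)} (hA : IsCompact A) (t : ℝ) :
    IsCompact {v : Fin n → ℝ | (Fin.cons t v : Fin (n + 1) → ℝ) ∈ A} := by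
  have h1 : IsClosed {v : Fin n → ℝ | (Fin.cons t v : Fin (n + 1) → ℝ) ∈ A} :=
    hA.isClosed.preimage (by fun_prop)
  refine (hA.image (f := fun w : Fin (n + 1) → ℝ => Fin.tail w) (by
    unfold Fin.tail; fun_prop)).of_isClosed_subset h1 ?_
  intro v hv
  exact ⟨_, hv, by simp⟩

lemma slice_bound {n : ℕ} {A : Set (Fin (n + 1) → ℝ)} (hA : IsCompact A) :
    ∃ C : ℝ≥0∞, C ≠ ∞ ∧
      ∀ t : ℝ, volume {v : Fin n → ℝ | (Fin.cons t v : Fin (n + 1) → ℝ) ∈ A} ≤ C := by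
  have h2 := (hA.image (f := fun w : Fin (n + 1) → ℝ => (Fin.tail w : Fin n → ℝ)) (by
    unfold Fin.tail; fun_prop))
  refine ⟨_, h2.measure_lt_top.ne, fun t => measure_mono ?_⟩
  intro v hv
  exact ⟨_, hv, by simp⟩

/-- Multiplicative Brunn-Minkowski for compact sets. -/
lemma bm_mult : ∀ (n : ℕ) (A B : Set (Fin n → ℝ)), IsCompact A → IsCompact B → 
    ∀ l k : ℝ, 0 < l → 0 < k → l + k = 1 →
    volume A ^ l * volume B ^ k ≤ volume (l • A + k • B) := by
  intro n
  induction n with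
  | zero =>
    intro A B hA hB l k hl hk hlk
    rcases A.eq_empty_or_nonempty with rfl | hA0
    · simp [hl]
    rcases B.eq_empty_or_nonempty with rfl | hB0
    · simp [hk]
    have e : ∀ S : Set (Fin 0 → ℝ), S.Nonempty → S = univ := fun S hS =>
      Subsingleton.eq_univ_of_nonempty hS
    rw [e A hA0, e B hB0, e _ ((univ_nonempty.smul_set).add (univ_nonempty.smul_set))]
    simp [volume_pi]
  | succ n ih =>
    intro A B hA hB l k hl hk hlk
    have hS : IsCompact (l • A + k • B) := (hA.smul l).add (hB.smul k)
    rw [(vol_slice hA).2, (vol_slice hB).2, (vol_slice hS).2]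
    obtain ⟨C, hC, hAC⟩ := slice_bound hA
    obtain ⟨C', hC', hBC⟩ := slice_bound hB
    refine pl_one (vol_slice hA).1 (vol_slice hB).1 (vol_slice hS).1 (C := max C C')
      (by simp [hC, hC']) (fun x => (hAC x).trans (le_max_left _ _))
      (fun x => (hBC x).trans (le_max_right _ _)) hl hk hlk ?_
    intro x y
    refine (ih _ _ (slice_compact hA x) (slice_compact hB y) l k hl hk hlk).trans ?_
    apply measure_mono
    rintro _ ⟨_, ⟨v, hv, rfl⟩, _, ⟨w, hw, rfl⟩, rfl⟩
    refine ⟨_, ⟨_, hv, rfl⟩, _, ⟨_, hw, rfl⟩, ?_⟩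
    ext i
    refine Fin.cases ?_ (fun i => ?_) i <;> simp

lemma bm_mult_euc {n : ℕ} {A B : Set (EuclideanSpace ℝ (Fin n))} (hA : IsCompact A)
    (hB : IsCompact B) {l k : ℝ} (hl : 0 < l) (hk : 0 < k) (hlk : l + k = 1) :
    volume A ^ l * volume B ^ k ≤ volume (l • A + k • B) := by
  have hp := PiLp.volume_preserving_toLp (Fin n)
  have hS : IsCompact (l • A + k • B) := (hA.smul l).add (hB.smul k)
  rw [← hp.measure_preimage hA.measurableSet.nullMeasurableSet,
    ← hp.measure_preimage hB.measurableSet.nullMeasurableSet,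
    ← hp.measure_preimage hS.measurableSet.nullMeasurableSet]
  have hc : ∀ S : Set (EuclideanSpace ℝ (Fin n)), IsCompact S →
      IsCompact ((WithLp.toLp 2 : (Fin n → ℝ) → EuclideanSpace ℝ (Fin n)) ⁻¹' S) := by
    intro S hS
    exact ((PiLp.continuousLinearEquiv 2 ℝ (fun _ : Fin n => ℝ)).symm.toHomeomorph.isCompact_preimage).2 hS
  refine (bm_mult n _ _ (hc A hA) (hc B hB) l k hl hk hlk).trans (measure_mono ?_)
  rintro _ ⟨_, ⟨v, hv, rfl⟩, _, ⟨w, hw, rfl⟩, rfl⟩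
  exact ⟨_, ⟨_, hv, rfl⟩, _, ⟨_, hw, rfl⟩, rfl⟩

/-- The radius-like functional `|K|^{1/n}`. -/
noncomputable def volRoot {n : ℕ} (K : ConvexBody (EuclideanSpace ℝ (Fin n))) : ℝ :=
  (volume (K : Set (EuclideanSpace ℝ (Fin n)))).toReal ^ ((1 : ℝ) / n)

section VolRoot
variable {n : ℕ}

lemma volRoot_nonneg (K : ConvexBody (EuclideanSpace ℝ (Fin n))) : 0 ≤ volRoot K := by
  unfold volRoot; positivity

lemma volRoot_mono {K : ConvexBody (EuclideanSpace ℝ (Fin n))}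
    {S : Set (EuclideanSpace ℝ (Fin n))} (hS : IsCompact S)
    (h : (K : Set (EuclideanSpace ℝ (Fin n))) ⊆ S) :
    volRoot K ≤ (volume S).toReal ^ ((1 : ℝ) / n) := by
  unfold volRoot
  have := ENNReal.toReal_mono hS.measure_lt_top.ne (measure_mono (μ := volume) h)
  gcongr

lemma volRoot_smul (hn : n ≠ 0) (c : ℝ≥0) (K : ConvexBody (EuclideanSpace ℝ (Fin n))) :
    volRoot (c • K) = c * volRoot K := by
  unfold volRoot
  have e : (volume ((c • K : ConvexBody (EuclideanSpace ℝ (Fin n))) :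
      Set (EuclideanSpace ℝ (Fin n)))).toReal = (c : ℝ) ^ n *
      (volume (K : Set (EuclideanSpace ℝ (Fin n)))).toReal := by
    rw [ConvexBody.coe_smul', show c • (K : Set (EuclideanSpace ℝ (Fin n))) = 
      (c : ℝ) • (K : Set (EuclideanSpace ℝ (Fin n))) from rfl, Measure.addHaar_smul]
    simp
  rw [e, Real.mul_rpow (by positivity) (by positivity), one_div,
    Real.pow_rpow_inv_natCast c.coe_nonneg hn]

lemma volRoot_pow (hn : n ≠ 0) (K : ConvexBody (EuclideanSpace ℝ (Fin n))) :
    volRoot K ^ n = (volume (K : Set (EuclideanSpace ℝ (Fin n)))).toReal := by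
  unfold volRoot
  rw [one_div, Real.rpow_inv_natCast_pow (by positivity) hn]

lemma volRoot_le_add_left (K L : ConvexBody (EuclideanSpace ℝ (Fin n))) :
    volRoot L ≤ volRoot (K + L) := by
  obtain ⟨a, ha⟩ := K.nonempty
  have h1 : volume (L : Set (EuclideanSpace ℝ (Fin n))) ≤
      volume ((K + L : ConvexBody (EuclideanSpace ℝ (Fin n))) :
        Set (EuclideanSpace ℝ (Fin n))) := by
    rw [← measure_preimage_add volume (-a), ← image_add_left]
    apply measure_mono
    rintro _ ⟨x, hx, rfl⟩
    exact add_mem_add ha hx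
  have := ENNReal.toReal_mono (K + L).isCompact.measure_lt_top.ne h1
  unfold volRoot
  gcongr

lemma volRoot_add (hn : n ≠ 0) (K L : ConvexBody (EuclideanSpace ℝ (Fin n))) :
    volRoot K + volRoot L ≤ volRoot (K + L) := by
  rcases (volRoot_nonneg K).eq_or_lt with hK | hK
  · rw [← hK, zero_add]; exact volRoot_le_add_left K L
  rcases (volRoot_nonneg L).eq_or_lt with hL | hL
  · rw [← hL, add_zero, add_comm K L]; exact volRoot_le_add_left L K
  set a := volRoot K with ha
  set b := volRoot L with hb
  have hab : 0 < a + b := by linarith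
  have key : ∀ M : ConvexBody (EuclideanSpace ℝ (Fin n)), 0 < volRoot M → 
      volume ((Real.toNNReal (volRoot M)⁻¹ • M : ConvexBody (EuclideanSpace ℝ (Fin n))) :
        Set (EuclideanSpace ℝ (Fin n))) = 1 := by
    intro M hM
    have h1 : volRoot (Real.toNNReal (volRoot M)⁻¹ • M) = 1 := by
      rw [volRoot_smul hn, Real.coe_toNNReal _ (by positivity), inv_mul_cancel₀ hM.ne']
    have h2 := volRoot_pow hn (Real.toNNReal (volRoot M)⁻¹ • M)
    rw [h1, one_pow] at h2
    exact (ENNReal.toReal_eq_one_iff _).1 h2.symm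
  have h1 := bm_mult_euc (Real.toNNReal a⁻¹ • K).isCompact (Real.toNNReal b⁻¹ • L).isCompact
    (l := a / (a + b)) (k := b / (a + b)) (by positivity) (by positivity) (by field_simp)
  rw [key K hK, key L hL] at h1
  simp only [ENNReal.one_rpow, mul_one] at h1
  have h2 : (a / (a + b)) • ((Real.toNNReal a⁻¹ • K : ConvexBody (EuclideanSpace ℝ (Fin n))) :
        Set (EuclideanSpace ℝ (Fin n))) + (b / (a + b)) • ((Real.toNNReal b⁻¹ • L :
        ConvexBody (EuclideanSpace ℝ (Fin n))) : Set (EuclideanSpace ℝ (Fin n))) =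
      ((Real.toNNReal (a + b)⁻¹ • (K + L) : ConvexBody (EuclideanSpace ℝ (Fin n))) :
        Set (EuclideanSpace ℝ (Fin n))) := by
    have e : ∀ (c : ℝ) (hc : 0 < c) (S : Set (EuclideanSpace ℝ (Fin n))),
        Real.toNNReal c⁻¹ • S = c⁻¹ • S := by
      intro c hc S
      change ((Real.toNNReal c⁻¹ : ℝ≥0) : ℝ) • S = _
      rw [Real.coe_toNNReal _ (by positivity)]
    rw [ConvexBody.coe_smul', ConvexBody.coe_smul', ConvexBody.coe_smul', e a hK, e b hL,
      e _ hab, smul_smul, smul_smul, ConvexBody.coe_add, smul_add]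
    congr 2 <;> field_simp
  rw [h2] at h1
  have h3 : 1 ≤ volRoot (Real.toNNReal (a + b)⁻¹ • (K + L)) := by
    unfold volRoot
    apply Real.one_le_rpow _ (by positivity)
    rw [← ENNReal.toReal_one]
    exact ENNReal.toReal_mono (ConvexBody.isCompact _).measure_lt_top.ne h1
  rw [volRoot_smul hn, Real.coe_toNNReal _ (by positivity)] at h3
  rwa [le_inv_mul_iff₀ hab, mul_one] at h3

lemma volRoot_sum (hn : n ≠ 0) {ι : Type*} (s : Finset ι) (c : ι → ℝ≥0)
    (K : ι → ConvexBody (EuclideanSpace ℝ (Fin n))) :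
    ∑ i ∈ s, (c i : ℝ) * volRoot (K i) ≤ volRoot (∑ i ∈ s, c i • K i) := by
  classical
  induction s using Finset.induction_on with
  | empty => simpa using volRoot_nonneg _
  | insert i s hi ih =>
    rw [Finset.sum_insert hi, Finset.sum_insert hi, ← volRoot_smul hn]
    exact (add_le_add_right ih _).trans (volRoot_add hn _ _)

end VolRoot

section Supp
variable {n : ℕ}

lemma suppFn_bdd (K : ConvexBody (EuclideanSpace ℝ (Fin n))) (ξ : EuclideanSpace ℝ (Fin n)) :
    BddAbove ((fun ζ => ⟪ζ, ξ⟫) '' (K : Set (EuclideanSpace ℝ (Fin n)))) :=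
  (K.isCompact.image (by fun_prop)).bddAbove

lemma le_suppFn (K : ConvexBody (EuclideanSpace ℝ (Fin n))) (ξ : EuclideanSpace ℝ (Fin n))
    {x : EuclideanSpace ℝ (Fin n)} (hx : x ∈ (K : Set (EuclideanSpace ℝ (Fin n)))) :
    ⟪x, ξ⟫ ≤ suppFn (K : Set (EuclideanSpace ℝ (Fin n))) ξ :=
  le_csSup (suppFn_bdd K ξ) ⟨x, hx, rfl⟩

lemma suppFn_le (K : ConvexBody (EuclideanSpace ℝ (Fin n))) (ξ : EuclideanSpace ℝ (Fin n))
    {c : ℝ} (h : ∀ x ∈ (K : Set (EuclideanSpace ℝ (Fin n))), ⟪x, ξ⟫ ≤ c) :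
    suppFn (K : Set (EuclideanSpace ℝ (Fin n))) ξ ≤ c := by
  refine csSup_le (K.nonempty.image _) ?_
  rintro _ ⟨x, hx, rfl⟩
  exact h x hx

lemma subset_of_suppFn_le {K L : ConvexBody (EuclideanSpace ℝ (Fin n))}
    (h : ∀ ξ, suppFn (K : Set (EuclideanSpace ℝ (Fin n))) ξ ≤
      suppFn (L : Set (EuclideanSpace ℝ (Fin n))) ξ) :
    (K : Set (EuclideanSpace ℝ (Fin n))) ⊆ L := by
  intro x hx
  by_contra hxL
  obtain ⟨f, u, hf, hu⟩ := geometric_hahn_banach_closed_point L.convex L.isClosed hxL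
  obtain ⟨ξ, rfl⟩ := (InnerProductSpace.toDual ℝ (EuclideanSpace ℝ (Fin n))).surjective f
  simp only [InnerProductSpace.toDual_apply_apply] at hf hu
  have h1 := (le_suppFn K ξ hx).trans (h ξ)
  have h2 := suppFn_le L ξ (c := u) (fun y hy => by
    rw [real_inner_comm]; exact (hf y hy).le)
  rw [real_inner_comm] at hu
  linarith

lemma suppFn_add_le (K L : ConvexBody (EuclideanSpace ℝ (Fin n)))
    (ξ : EuclideanSpace ℝ (Fin n)) :
    suppFn ((K + L : ConvexBody (EuclideanSpace ℝ (Fin n))) : Set (EuclideanSpace ℝ (Fin n))) ξ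
      ≤ suppFn (K : Set (EuclideanSpace ℝ (Fin n))) ξ +
        suppFn (L : Set (EuclideanSpace ℝ (Fin n))) ξ := by
  refine suppFn_le _ _ ?_
  rintro _ ⟨x, hx, y, hy, rfl⟩
  simp only [inner_add_left]
  exact add_le_add (le_suppFn K ξ hx) (le_suppFn L ξ hy)

lemma suppFn_smul_le (c : ℝ≥0) (K : ConvexBody (EuclideanSpace ℝ (Fin n)))
    (ξ : EuclideanSpace ℝ (Fin n)) :
    suppFn ((c • K : ConvexBody (EuclideanSpace ℝ (Fin n))) : Set (EuclideanSpace ℝ (Fin n))) ξ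
      ≤ c * suppFn (K : Set (EuclideanSpace ℝ (Fin n))) ξ := by
  refine suppFn_le _ _ ?_
  rintro _ ⟨x, hx, rfl⟩
  change ⟪(c : ℝ) • x, ξ⟫ ≤ _
  rw [real_inner_smul_left]
  exact mul_le_mul_of_nonneg_left (le_suppFn K ξ hx) c.2

lemma suppFn_sum_le {ι : Type*} (s : Finset ι) (c : ι → ℝ≥0)
    (K : ι → ConvexBody (EuclideanSpace ℝ (Fin n))) (ξ : EuclideanSpace ℝ (Fin n)) :
    suppFn ((∑ i ∈ s, c i • K i : ConvexBody (EuclideanSpace ℝ (Fin n))) :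
      Set (EuclideanSpace ℝ (Fin n))) ξ
      ≤ ∑ i ∈ s, c i * suppFn (K i : Set (EuclideanSpace ℝ (Fin n))) ξ := by
  classical
  induction s using Finset.induction_on with
  | empty =>
    refine suppFn_le _ _ ?_
    intro x hx
    simp only [Finset.sum_empty, ConvexBody.coe_zero] at hx
    rw [Set.mem_zero] at hx
    simp [hx]
  | insert i s hi ih =>
    rw [Finset.sum_insert hi, Finset.sum_insert hi]
    exact (suppFn_add_le _ _ _).trans (add_le_add (suppFn_smul_le _ _ _) ih)

lemma suppFn_le_add_dist (K L : ConvexBody (EuclideanSpace ℝ (Fin n)))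
    (ξ : EuclideanSpace ℝ (Fin n)) :
    suppFn (K : Set (EuclideanSpace ℝ (Fin n))) ξ ≤
      suppFn (L : Set (EuclideanSpace ℝ (Fin n))) ξ + dist K L * ‖ξ‖ := by
  refine suppFn_le _ _ fun x hx => ?_
  obtain ⟨y, hy, hxy⟩ := L.isCompact.exists_infDist_eq_dist L.nonempty x
  have h1 : dist x y ≤ dist K L := by
    rw [← hxy, ← ConvexBody.hausdorffDist_coe]
    exact infDist_le_hausdorffDist_of_mem hx ConvexBody.hausdorffEDist_ne_top
  have h2 : ⟪x - y, ξ⟫ ≤ dist K L * ‖ξ‖ := by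
    refine (real_inner_le_norm _ _).trans ?_
    rw [← dist_eq_norm]
    gcongr
  have h3 := le_suppFn L ξ hy
  rw [inner_sub_left] at h2
  linarith

lemma suppFn_lipschitz (ξ : EuclideanSpace ℝ (Fin n)) :
    Continuous (fun K : ConvexBody (EuclideanSpace ℝ (Fin n)) =>
      suppFn (K : Set (EuclideanSpace ℝ (Fin n))) ξ) := by
  refine (LipschitzWith.of_dist_le_mul (K := ‖ξ‖₊) fun K L => ?_).continuous
  rw [Real.dist_eq, abs_le]
  have h1 := suppFn_le_add_dist K L ξ
  have h2 := suppFn_le_add_dist L K ξ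
  rw [dist_comm L K] at h2
  simp only [coe_nnnorm]
  constructor <;> linarith

/-- The closed ball as a convex body. -/
noncomputable def ballBody (n : ℕ) {δ : ℝ} (hδ : 0 ≤ δ) :
    ConvexBody (EuclideanSpace ℝ (Fin n)) where
  carrier := closedBall 0 δ
  convex' := convex_closedBall _ _
  isCompact' := isCompact_closedBall _ _
  nonempty' := ⟨0, by simpa using hδ⟩

lemma le_suppFn_add_ball (K : ConvexBody (EuclideanSpace ℝ (Fin n))) {δ : ℝ} (hδ : 0 ≤ δ)
    (ξ : EuclideanSpace ℝ (Fin n)) :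
    suppFn (K : Set (EuclideanSpace ℝ (Fin n))) ξ + δ * ‖ξ‖ ≤
    suppFn ((K + ballBody n hδ : ConvexBody (EuclideanSpace ℝ (Fin n))) :
      Set (EuclideanSpace ℝ (Fin n))) ξ := by
  rw [← le_sub_iff_add_le]
  refine suppFn_le _ _ fun x hx => ?_
  rw [le_sub_iff_add_le]
  have hb : δ • (‖ξ‖⁻¹ • ξ) ∈ closedBall (0 : EuclideanSpace ℝ (Fin n)) δ := by
    rw [mem_closedBall_zero_iff, norm_smul, Real.norm_of_nonneg hδ, norm_smul, norm_inv,
      norm_norm]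
    exact mul_le_of_le_one_right hδ inv_mul_le_one
  have := le_suppFn (K + ballBody n hδ) ξ (add_mem_add hx hb)
  rw [inner_add_left, real_inner_smul_left, real_inner_smul_left,
    real_inner_self_eq_norm_sq] at this
  convert this using 3
  by_cases h : ‖ξ‖ = 0
  · simp [h]
  · field_simp

lemma add_ball_subset (K : ConvexBody (EuclideanSpace ℝ (Fin n))) {δ : ℝ} (hδ : 0 ≤ δ) :
    ((K + ballBody n hδ : ConvexBody (EuclideanSpace ℝ (Fin n))) :
      Set (EuclideanSpace ℝ (Fin n))) ⊆ cthickening δ (K : Set (EuclideanSpace ℝ (Fin n))) := by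
  rintro _ ⟨x, hx, y, hy, rfl⟩
  refine mem_cthickening_of_dist_le _ x _ _ hx ?_
  have : y ∈ closedBall (0 : EuclideanSpace ℝ (Fin n)) δ := hy
  simpa using this

end Supp

section Integral

lemma sum_le_integral {X : Type*} [MeasurableSpace X] {μ : Measure X} [IsFiniteMeasure μ]
    (φ : SimpleFunc X X) (a : X → ℝ) (G : X → ℝ) (hG : Integrable G μ)
    (h : ∀ᵐ y ∂μ, a (φ y) ≤ G y) :
    ∑ q ∈ φ.range, μ.real (φ ⁻¹' {q}) * a q ≤ ∫ y, G y ∂μ := by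
  have e : ∫ y, G y ∂μ = ∑ q ∈ φ.range, ∫ y in φ ⁻¹' {q}, G y ∂μ := by
    rw [← integral_biUnion_finset]
    · rw [show (⋃ i ∈ φ.range, φ ⁻¹' {i}) = univ from by ext y; simp, Measure.restrict_univ]
    · intro i _; exact φ.measurableSet_fiber i
    · intro i _ j _ hij
      exact Disjoint.preimage _ (by simpa using hij)
    · intro i _; exact hG.integrableOn
  rw [e]
  refine Finset.sum_le_sum fun q _ => ?_
  rw [← smul_eq_mul, ← setIntegral_const]
  refine integral_mono_ae (integrable_const _) hG.integrableOn ?_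
  filter_upwards [ae_restrict_of_ae h, ae_restrict_mem (φ.measurableSet_fiber q)] with y hy hq
  rw [mem_preimage, mem_singleton_iff] at hq
  rwa [hq] at hy

lemma main_ineq {n m : ℕ} (hn : n ≠ 0) (μ : Measure (EuclideanSpace ℝ (Fin m)))
    [IsFiniteMeasure μ] (hμ : μ.real univ ≤ 1) {S : Set (EuclideanSpace ℝ (Fin m))}
    (hS : IsCompact S) (hμS : ∀ᵐ y ∂μ, y ∈ S) (hμr : μ.restrict S = μ)
    (U : EuclideanSpace ℝ (Fin m) → ConvexBody (EuclideanSpace ℝ (Fin n)))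
    (hU : ContinuousOn U S) {R : ℝ}
    (hR : ∀ w ∈ S, (U w : Set (EuclideanSpace ℝ (Fin n))) ⊆ Metric.closedBall 0 R)
    (K : ConvexBody (EuclideanSpace ℝ (Fin n)))
    (hK : ∀ ξ, ∫ y, suppFn (U y : Set (EuclideanSpace ℝ (Fin n))) ξ ∂μ ≤
      suppFn (K : Set (EuclideanSpace ℝ (Fin n))) ξ) :
    ∫ y, volRoot (U y) ∂μ ≤ volRoot K := by
  by_cases hvInt : Integrable (fun y => volRoot (U y)) μ
  swap
  · rw [integral_undef hvInt]; exact volRoot_nonneg K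
  have step : ∀ δ : ℝ, 0 < δ → ∫ y, volRoot (U y) ∂μ ≤
      (volume (cthickening δ (K : Set (EuclideanSpace ℝ (Fin n))))).toReal ^ ((1 : ℝ) / n) + δ := by
    intro δ hδ
    have huc := hS.uniformContinuousOn_of_continuous hU
    rw [Metric.uniformContinuousOn_iff] at huc
    obtain ⟨r, hr, huc⟩ := huc δ hδ
    let e := TopologicalSpace.denseSeq (EuclideanSpace ℝ (Fin m))
    obtain ⟨t, ht⟩ := hS.elim_finite_subcover (fun k : ℕ => ball (e k) (r / 2))
      (fun k => isOpen_ball) (by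
        intro y _
        obtain ⟨k, hk⟩ := (TopologicalSpace.denseRange_denseSeq
          (EuclideanSpace ℝ (Fin m))).exists_dist_lt y (half_pos hr)
        exact mem_iUnion.2 ⟨k, hk⟩)
    obtain ⟨N, hN⟩ : ∃ N, ∀ k ∈ t, k ≤ N := ⟨t.sup id, fun k hk => Finset.le_sup (f := id) hk⟩
    let φ := SimpleFunc.nearestPt e N
    have hφ : ∀ y ∈ S, dist (φ y) y < r / 2 := by
      intro y hy
      obtain ⟨k, hk, hky⟩ := mem_iUnion₂.1 (ht hy)
      have h1 := SimpleFunc.edist_nearestPt_le e y (hN k hk)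
      rw [edist_dist, edist_dist, ENNReal.ofReal_le_ofReal_iff dist_nonneg] at h1
      refine h1.trans_lt ?_
      rw [dist_comm]; exact hky
    have hz : ∀ q, ∃ z, ∀ y ∈ S, φ y = q → dist (U z) (U y) ≤ δ ∧
        volRoot (U y) ≤ volRoot (U z) + δ := by
      intro q
      by_cases hne : (S ∩ φ ⁻¹' {q}).Nonempty
      swap
      · exact ⟨q, fun y hy hq => absurd ⟨y, hy, hq⟩ hne⟩
      have hb : BddAbove ((fun y => volRoot (U y)) '' (S ∩ φ ⁻¹' {q})) := by
        refine ⟨(volume (closedBall (0 : EuclideanSpace ℝ (Fin n)) R)).toReal ^ ((1 : ℝ) / n), ?_⟩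
        rintro _ ⟨y, hy, rfl⟩
        exact volRoot_mono (isCompact_closedBall 0 R) (hR y hy.1)
      obtain ⟨_, ⟨z, hz, rfl⟩, hz2⟩ := exists_lt_of_lt_csSup (hne.image _)
        (sub_lt_self (sSup ((fun y => volRoot (U y)) '' (S ∩ φ ⁻¹' {q}))) hδ)
      refine ⟨z, fun y hy hq => ⟨?_, ?_⟩⟩
      · refine (huc z hz.1 y hy ?_).le
        have h1 := hφ z hz.1
        have h2 := hφ y hy
        have hzq : φ z = q := hz.2
        rw [hzq, dist_comm] at h1
        rw [hq] at h2
        have := dist_triangle z q y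
        linarith
      · have := le_csSup hb ⟨y, ⟨hy, hq⟩, rfl⟩
        simp only at this hz2
        linarith
    choose z hz using hz
    let c : EuclideanSpace ℝ (Fin m) → ℝ≥0 := fun q => ⟨μ.real (φ ⁻¹' {q}), measureReal_nonneg⟩
    let M : ConvexBody (EuclideanSpace ℝ (Fin n)) := ∑ q ∈ φ.range, c q • U (z q)
    have hconst : ∀ b : ℝ, 0 ≤ b → ∫ _, b ∂μ ≤ b := by
      intro b hb
      rw [integral_const, smul_eq_mul]
      exact mul_le_of_le_one_left hb hμ
    have hM : (M : Set (EuclideanSpace ℝ (Fin n))) ⊆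
        cthickening δ (K : Set (EuclideanSpace ℝ (Fin n))) := by
      refine (subset_of_suppFn_le (L := K + ballBody n hδ.le) fun ξ => ?_).trans
        (add_ball_subset K hδ.le)
      refine le_trans ?_ (le_suppFn_add_ball K hδ.le ξ)
      refine (suppFn_sum_le _ _ _ ξ).trans ?_
      have hi : Integrable (fun y => suppFn (U y : Set (EuclideanSpace ℝ (Fin n))) ξ) μ := by
        have : IntegrableOn (fun y => suppFn (U y : Set (EuclideanSpace ℝ (Fin n))) ξ) S μ :=
          ContinuousOn.integrableOn_compact hS ((suppFn_lipschitz ξ).comp_continuousOn hU)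
        rwa [IntegrableOn, hμr] at this
      have h1 := sum_le_integral φ (fun q => suppFn (U (z q) : Set (EuclideanSpace ℝ (Fin n))) ξ)
        (fun y => suppFn (U y : Set (EuclideanSpace ℝ (Fin n))) ξ + δ * ‖ξ‖)
        (hi.add (integrable_const _)) (by
          filter_upwards [hμS] with y hy
          refine (suppFn_le_add_dist _ (U y) ξ).trans ?_
          have := (hz _ y hy rfl).1
          gcongr)
      refine h1.trans ?_
      rw [integral_add hi (integrable_const _)]
      exact add_le_add (hK ξ) (hconst _ (by positivity))
    have h2 := sum_le_integral φ (fun q => - volRoot (U (z q))) (fun y => - volRoot (U y) + δ)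
      (hvInt.neg.add (integrable_const _)) (by
        filter_upwards [hμS] with y hy
        have := (hz _ y hy rfl).2
        linarith)
    rw [integral_add (f := fun y => - volRoot (U y)) hvInt.neg (integrable_const _),
      integral_neg] at h2
    simp only [mul_neg, Finset.sum_neg_distrib] at h2
    have h3 := hconst δ hδ.le
    have h4 := volRoot_sum hn φ.range c (fun q => U (z q))
    have h5 := volRoot_mono K.isCompact.cthickening hM
    have h6 : ∑ i ∈ φ.range, (c i : ℝ) * volRoot (U (z i)) =
      ∑ q ∈ φ.range, μ.real (φ ⁻¹' {q}) * volRoot (U (z q)) := rfl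
    change _ ≤ volRoot M at h4
    linarith
  have hlim : Tendsto (fun δ : ℝ =>
      (volume (cthickening δ (K : Set (EuclideanSpace ℝ (Fin n))))).toReal ^ ((1 : ℝ) / n) + δ)
      (𝓝[>] 0) (𝓝 (volRoot K)) := by
    have h1 := (tendsto_measure_cthickening_of_isCompact (μ := volume) K.isCompact).mono_left
      (nhdsWithin_le_nhds (s := Ioi (0 : ℝ)))
    have h2 := ((ENNReal.tendsto_toReal K.isCompact.measure_lt_top.ne).comp h1).rpow_const
      (p := (1 : ℝ) / n) (.inr (by positivity))
    have h3 := h2.add (tendsto_nhdsWithin_of_tendsto_nhds (s := Ioi (0 : ℝ)) (tendsto_id (α := ℝ)))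
    simpa [volRoot] using h3
  refine ge_of_tendsto hlim ?_
  filter_upwards [self_mem_nhdsWithin] with δ hδ using step δ hδ

end Integral

/-- If `w ↦ U_w` is a continuous bounded family of convex bodies whose support
functions `w ↦ h_{U_w}(ξ)` are all superharmonic (super-mean-value property), then the
family is subharmonic (each `U_x` contains the Minkowski integral over spheres), and
consequently `w ↦ |U_w|^{1/n}` is superharmonic. -/
theorem superharmonic_support_functions_give_subharmonic_family {n m : ℕ}
    (Ω : Set (EuclideanSpace ℝ (Fin m))) (hΩ : IsOpen Ω)
    (U : EuclideanSpace ℝ (Fin m) → ConvexBody (EuclideanSpace ℝ (Fin n)))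
    (hU : ContinuousOn U Ω)
    (hbdd : ∃ R : ℝ, ∀ w ∈ Ω, (U w : Set (EuclideanSpace ℝ (Fin n)))
      ⊆ Metric.closedBall 0 R)
    (hsuper : ∀ ξ, ∀ x ε, 0 < ε → Metric.closedBall x ε ⊆ Ω →
      suppFn (U x : Set (EuclideanSpace ℝ (Fin n))) ξ
        ≥ ∫ y, suppFn (U y : Set (EuclideanSpace ℝ (Fin n))) ξ ∂(sphereMeasure x ε)) :
    (∀ x ε, 0 < ε → Metric.closedBall x ε ⊆ Ω →
      ∀ K : ConvexBody (EuclideanSpace ℝ (Fin n)),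
        (∀ ξ, suppFn (K : Set (EuclideanSpace ℝ (Fin n))) ξ
          = ∫ y, suppFn (U y : Set (EuclideanSpace ℝ (Fin n))) ξ ∂(sphereMeasure x ε)) →
        (K : Set (EuclideanSpace ℝ (Fin n))) ⊆ (U x : Set (EuclideanSpace ℝ (Fin n)))) ∧
    (∀ x ε, 0 < ε → Metric.closedBall x ε ⊆ Ω →
      (volume (U x : Set (EuclideanSpace ℝ (Fin n)))).toReal ^ ((1 : ℝ) / n)
        ≥ ∫ y, (volume (U y : Set (EuclideanSpace ℝ (Fin n)))).toReal ^ ((1 : ℝ) / n)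
            ∂(sphereMeasure x ε)) := by
  obtain ⟨R, hR⟩ := hbdd
  refine ⟨fun x ε hε hx K hK => subset_of_suppFn_le fun ξ => ?_, fun x ε hε hx => ?_⟩
  · rw [hK]; exact hsuper ξ x ε hε hx
  have hle : sphereMeasure x ε univ ≤ 1 := by
    simp only [sphereMeasure, Measure.smul_apply, Measure.restrict_apply_univ, smul_eq_mul]
    exact ENNReal.inv_mul_le_one _
  have : IsFiniteMeasure (sphereMeasure x ε) := ⟨hle.trans_lt ENNReal.one_lt_top⟩
  have hle' : (sphereMeasure x ε).real univ ≤ 1 :=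
    ENNReal.toReal_le_of_le_ofReal zero_le_one (by simpa using hle)
  rcases eq_or_ne n 0 with rfl | hn
  · simpa using hle'
  have hr : (sphereMeasure x ε).restrict (sphere x ε) = sphereMeasure x ε := by
    rw [sphereMeasure, Measure.restrict_smul, Measure.restrict_restrict isClosed_sphere.measurableSet,
      inter_self]
  have hsub : sphere x ε ⊆ Ω := sphere_subset_closedBall.trans hx
  refine main_ineq hn (sphereMeasure x ε) hle' (isCompact_sphere x ε) ?_ hr U (hU.mono hsub)
    (fun w hw => hR w (hsub hw)) (U x) (fun ξ => hsuper ξ x ε hε hx)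
  rw [← hr]
  exact ae_restrict_mem isClosed_sphere.measurableSet
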